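/- (Reduction to an integral estimate.) Let α̃ be any real number and α₀, α₁, α₂ ≥ 0. If the integral I_{τ,ξ} := ∫_{|η| ≤ |ξ−η|} |ξ|^{2α̃} ⟨ξ⟩^{2α₀} / (⟨η⟩^{2 max{α₁,α₂}} ⟨ξ−η⟩^{2 min{α₁,α₂}}) δ(τ + |η|² − |ξ−η|²) dη is bounded uniformly in τ ∈ ℝ and ξ ∈ ℝ^d, then the Strichartz estimate ‖ |∇|^{α̃} ρ_{e^{itΔ} γ₀ e^{−itΔ}} ‖_{L²_t(ℝ; H^{α₀}_x)} ≲ ‖⟨∇⟩^{α₁} γ₀ ⟨∇⟩^{α₂}‖_{𝔖²} holds for all Hilbert–Schmidt operators γ₀ on L²(ℝ^d). -/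

import Mathlib

open MeasureTheory Complex Filter
open scoped ENNReal NNReal RealInnerProductSpace Topology ComplexConjugate

noncomputable section

/-- `d`-dimensional Euclidean space `ℝ^d`. -/
abbrev Vd (d : ℕ) := EuclideanSpace ℝ (Fin d)

/-- The Japanese bracket `⟨ξ⟩ = (1 + |ξ|²)^{1/2}`. -/
noncomputable def jb {d : ℕ} (ξ : Vd d) : ℝ := (1 + ‖ξ‖ ^ 2) ^ ((1 : ℝ) / 2)

/-- Fourier transform, with the paper's convention `ĥ(ξ) = ∫ e^{-i x·ξ} h(x) dx`. -/
noncomputable def ft {d : ℕ} (h : Vd d → ℂ) (ξ : Vd d) : ℂ :=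
  ∫ x : Vd d, Complex.exp (-(Complex.I * Complex.ofReal (⟪x, ξ⟫))) * h x

/-- Inverse Fourier transform `ǧ(x) = (2π)^{-d} ∫ e^{i x·ξ} g(ξ) dξ`. -/
noncomputable def invFt {d : ℕ} (h : Vd d → ℂ) (x : Vd d) : ℂ :=
  (((2 * Real.pi) ^ d)⁻¹ : ℝ) • ∫ ξ : Vd d, Complex.exp (Complex.I * Complex.ofReal (⟪x, ξ⟫)) * h ξ

/-- The space Fourier transform (at frequency `ξ`, time `t`) of the density of
`e^{itΔ} γ₀ e^{-itΔ}`, expressed via `G = γ̂₀`, the `2d`-dimensional Fourier transform of the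
integral kernel of `γ₀`:  `ρ̂(t,ξ) = (2π)^{-d} ∫ e^{-it(|η|²-|ξ-η|²)} G(η, ξ-η) dη`. -/
noncomputable def densFT {d : ℕ} (G : Vd d × Vd d → ℂ) (t : ℝ) (ξ : Vd d) : ℂ :=
  (((2 * Real.pi) ^ d)⁻¹ : ℝ) •
    ∫ η : Vd d, Complex.exp (-(Complex.I * Complex.ofReal (t * (‖η‖ ^ 2 - ‖ξ - η‖ ^ 2)))) * G (η, ξ - η)

/-- `‖ |∇|^s ρ_{e^{itΔ}γ₀e^{-itΔ}} ‖_{L²_t(ℝ; H^{α₀}_x)}`, computed on the space Fourier side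
(by Plancherel) from `G = γ̂₀`. -/
noncomputable def densStriNorm {d : ℕ} (s α₀ : ℝ) (G : Vd d × Vd d → ℂ) : ℝ≥0∞ :=
  (∫⁻ t : ℝ, ∫⁻ ξ : Vd d,
      ENNReal.ofReal (‖ξ‖ ^ (2 * s) * jb ξ ^ (2 * α₀)) * (‖densFT G t ξ‖₊ : ℝ≥0∞) ^ (2:ℝ)) ^ ((1:ℝ)/2)

/-- The weighted Hilbert–Schmidt norm `‖⟨∇⟩^{α₁} γ₀ ⟨∇⟩^{α₂}‖_{𝔖²}`, computed (by Plancherel)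
from `G = γ̂₀`. -/
noncomputable def wHSnorm {d : ℕ} (α₁ α₂ : ℝ) (G : Vd d × Vd d → ℂ) : ℝ≥0∞ :=
  (∫⁻ p : Vd d × Vd d,
      ENNReal.ofReal (jb p.1 ^ (2 * α₁) * jb p.2 ^ (2 * α₂)) * (‖G p‖₊ : ℝ≥0∞) ^ (2:ℝ)) ^ ((1:ℝ)/2)

/-- The delta-function integral `∫ F(η) δ(τ + |η|² - |ξ-η|²) dη`, interpreted as the surface
integral of `F` over the hyperplane `{η : 2 ξ·η = |ξ|² - τ}` with respect to the
`(d-1)`-dimensional Hausdorff measure, divided by `|∇_η(|η|²-|ξ-η|²)| = 2|ξ|`. -/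
noncomputable def deltaInt {d : ℕ} (F : Vd d → ℝ≥0∞) (τ : ℝ) (ξ : Vd d) : ℝ≥0∞ :=
  (∫⁻ η in {η : Vd d | 2 * (⟪ξ, η⟫) = ‖ξ‖ ^ 2 - τ}, F η ∂(μH[(d:ℝ) - 1])) /
    (2 * (‖ξ‖₊ : ℝ≥0∞))

/-- The integrand of `I_{τ,ξ}` from Lemma 3.4. -/
noncomputable def Iintegrand {d : ℕ} (s α₀ α₁ α₂ : ℝ) (ξ : Vd d) : Vd d → ℝ≥0∞ := fun η =>
  Set.indicator {η : Vd d | ‖η‖ ≤ ‖ξ - η‖}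
    (fun η => ENNReal.ofReal
      ((‖ξ‖ ^ (2 * s) * jb ξ ^ (2 * α₀)) /
        (jb η ^ (2 * max α₁ α₂) * jb (ξ - η) ^ (2 * min α₁ α₂)))) η

/-- Plancherel's inequality for integrable functions on the line. -/
lemma lintegral_fourier_sq_le {g : ℝ → ℂ} (hg : Integrable g) :
    ∫⁻ x, ‖FourierTransform.fourier g x‖ₑ ^ (2 : ℝ) ≤ ∫⁻ x, ‖g x‖ₑ ^ (2 : ℝ) := by
  by_cases htop : ∫⁻ x, ‖g x‖ₑ ^ (2 : ℝ) = ∞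
  · exact htop ▸ le_top
  have hL2 : MemLp g 2 := by
    refine ⟨hg.1, ?_⟩
    rw [eLpNorm_lt_top_iff_lintegral_rpow_enorm_lt_top two_ne_zero ENNReal.ofNat_ne_top]
    simpa [lt_top_iff_ne_top] using htop
  set f : Lp ℂ 2 (volume : Measure ℝ) := hL2.toLp g with hf
  have hcont : Continuous (FourierTransform.fourier g) :=
    VectorFourier.fourierIntegral_continuous Real.continuous_fourierChar
      (L := innerₗ ℝ) continuous_inner hg
  have key : ∀ᵐ x, (FourierTransform.fourier f : Lp ℂ 2 (volume : Measure ℝ)) x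
      = FourierTransform.fourier g x := by
    refine ae_eq_of_integral_contDiff_smul_eq ?_ hcont.locallyIntegrable ?_
    · exact (Lp.memLp _).locallyIntegrable (by norm_num)
    intro φ hφ hφc
    have hφ' : HasCompactSupport (fun x => (φ x : ℂ)) := hφc.comp_left Complex.ofReal_zero
    have hφs : ContDiff ℝ (↑(⊤ : ℕ∞)) (fun x => (φ x : ℂ)) := Complex.ofRealCLM.contDiff.comp hφ
    set ψ : SchwartzMap ℝ ℂ := hφ'.toSchwartzMap hφs with hψ
    have hψx : ∀ x, ψ x = φ x := fun x => rfl
    have h1 := congrArg (fun T => T ψ) (Lp.fourier_toTemperedDistribution_eq f)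
    simp only [TemperedDistribution.fourier_apply, Lp.toTemperedDistribution_apply, hψx] at h1
    have h2 : ∫ x, (FourierTransform.fourier ψ) x • f x
        = ∫ x, FourierTransform.fourier (ψ : ℝ → ℂ) x • g x := by
      refine integral_congr_ae ?_
      filter_upwards [hL2.coeFn_toLp] with x hx
      rw [hf, hx, SchwartzMap.fourier_coe]
    have h3 : ∫ x, FourierTransform.fourier (ψ : ℝ → ℂ) x • g x
        = ∫ x, ψ x • FourierTransform.fourier g x := by
      simpa using! (VectorFourier.integral_fourierIntegral_smul_eq_flip (L := innerₗ ℝ)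
        Real.continuous_fourierChar continuous_inner ψ.integrable hg)
    simp only [hψx] at h3
    rw [h2, h3] at h1
    simpa using h1.symm
  have hn : eLpNorm (FourierTransform.fourier g) 2 volume = eLpNorm g 2 volume := by
    rw [← eLpNorm_congr_ae key, ← eLpNorm_congr_ae hL2.coeFn_toLp, ← Lp.enorm_def, ← Lp.enorm_def,
      ← ofReal_norm, ← ofReal_norm, Lp.norm_fourier_eq]
  have := congrArg (fun y => y ^ (2 : ℝ)) hn
  simp only [eLpNorm_eq_lintegral_rpow_enorm_toReal two_ne_zero ENNReal.ofNat_ne_top,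
    ← ENNReal.rpow_mul] at this
  simp at this
  simpa using this.le

/-- Weighted Cauchy–Schwarz inequality. -/
lemma lintegral_sq_le_mul_lintegral_inv_mul {X : Type*} [MeasurableSpace X] {μ : Measure X}
    {V f : X → ℝ≥0∞} (hV : AEMeasurable V μ) (hf : AEMeasurable f μ)
    (h0 : ∀ x, V x ≠ 0) (htop : ∀ x, V x ≠ ∞) :
    (∫⁻ x, f x ∂μ) ^ (2 : ℝ) ≤ (∫⁻ x, V x ∂μ) * ∫⁻ x, (V x)⁻¹ * f x ^ (2 : ℝ) ∂μ := by
  have h := ENNReal.lintegral_mul_le_Lp_mul_Lq μ (p := 2) (q := 2)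
    (by rw [Real.holderConjugate_iff]; norm_num)
    (f := fun x => V x ^ (1 / 2 : ℝ)) (g := fun x => (V x)⁻¹ ^ (1 / 2 : ℝ) * f x)
    (hV.pow_const _) ((hV.inv.pow_const _).mul hf)
  have h1 : ∀ x, ((fun x => V x ^ (1 / 2 : ℝ)) * fun x => (V x)⁻¹ ^ (1 / 2 : ℝ) * f x) x = f x := by
    intro x
    simp only [Pi.mul_apply]
    rw [← mul_assoc, ← ENNReal.mul_rpow_of_nonneg _ _ (by norm_num),
      ENNReal.mul_inv_cancel (h0 x) (htop x), ENNReal.one_rpow, one_mul]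
  have h2 : ∀ x, (V x ^ (1 / 2 : ℝ)) ^ (2 : ℝ) = V x := fun x => by
    rw [← ENNReal.rpow_mul]; norm_num
  have h3 : ∀ x, ((V x)⁻¹ ^ (1 / 2 : ℝ) * f x) ^ (2 : ℝ) = (V x)⁻¹ * f x ^ (2 : ℝ) := fun x => by
    rw [ENNReal.mul_rpow_of_nonneg _ _ (by norm_num), ← ENNReal.rpow_mul]; norm_num
  simp only [h1, h2, h3] at h
  calc _ ≤ _ := ENNReal.rpow_le_rpow h (by norm_num : (0 : ℝ) ≤ 2)
    _ = _ := by
      rw [ENNReal.mul_rpow_of_nonneg _ _ (by norm_num), ← ENNReal.rpow_mul, ← ENNReal.rpow_mul]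
      norm_num

/-- Euclidean space splits isometrically along a prescribed unit vector. -/
lemma exists_linearIsometryEquiv_inner_eq (n : ℕ) {v : Vd (n + 1)} (hv : ‖v‖ = 1) :
    ∃ Φ : WithLp 2 (ℝ × Vd n) ≃ₗᵢ[ℝ] Vd (n + 1), ∀ r w, ⟪v, Φ (WithLp.toLp 2 (r, w))⟫ = r := by
  have hfin : Module.finrank ℝ (WithLp 2 (ℝ × Vd n)) = n + 1 := by
    rw [(WithLp.linearEquiv 2 ℝ (ℝ × Vd n)).finrank_eq]
    simp [add_comm]
  let Φ₀ : WithLp 2 (ℝ × Vd n) ≃ₗᵢ[ℝ] Vd (n + 1) :=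
    ((stdOrthonormalBasis ℝ (WithLp 2 (ℝ × Vd n))).reindex (finCongr hfin)).repr
  set u : Vd (n + 1) := Φ₀ (WithLp.toLp 2 (1, 0)) with hu
  have hun : ‖u‖ = ‖v‖ := by
    rw [hv, hu, Φ₀.norm_map, WithLp.prod_norm_eq_of_L2]
    simp
  refine ⟨Φ₀.trans (ℝ ∙ (u - v))ᗮ.reflection, fun r w => ?_⟩
  have hv' : v = (ℝ ∙ (u - v))ᗮ.reflection u := (Submodule.reflection_sub hun).symm
  conv_lhs => enter [2]; rw [hv']
  rw [LinearIsometryEquiv.trans_apply, LinearIsometryEquiv.inner_map_map, hu,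
    LinearIsometryEquiv.inner_map_map, WithLp.prod_inner_apply]
  simp

/-- Hyperplanes orthogonal to `ξ`, parametrized isometrically and compatibly with volume. -/
lemma exists_measurePreserving_slicing (n : ℕ) {ξ : Vd (n + 1)} (hξ : ξ ≠ 0) :
    ∃ P : ℝ × Vd n → Vd (n + 1), MeasurePreserving P ∧ MeasurableEmbedding P ∧
      (∀ r w, ⟪ξ, P (r, w)⟫ = ‖ξ‖ * r) ∧ (∀ r, Isometry fun w => P (r, w)) ∧
      ∀ r, Set.range (fun w => P (r, w)) = {η | ⟪ξ, η⟫ = ‖ξ‖ * r} := by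
  have hξ' : ‖ξ‖ ≠ 0 := norm_ne_zero_iff.2 hξ
  obtain ⟨Φ, hΦ⟩ := exists_linearIsometryEquiv_inner_eq n (v := ‖ξ‖⁻¹ • ξ)
    (by rw [norm_smul, norm_inv, norm_norm, inv_mul_cancel₀ hξ'])
  have hin : ∀ r w, ⟪ξ, Φ (WithLp.toLp 2 (r, w))⟫ = ‖ξ‖ * r := fun r w => by
    have := hΦ r w
    rw [real_inner_smul_left] at this
    rw [← mul_inv_cancel_left₀ hξ' ⟪ξ, _⟫, this]
  refine ⟨fun p => Φ (WithLp.toLp 2 p), ?_, ?_, hin, ?_, ?_⟩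
  · exact Φ.measurePreserving.comp (WithLp.volume_preserving_toLp ℝ (Vd n))
  · exact Φ.toHomeomorph.measurableEmbedding.comp
      (WithLp.homeomorphProd 2 ℝ (Vd n)).symm.measurableEmbedding
  · intro r
    refine Φ.isometry.comp (Isometry.of_dist_eq fun w w' => ?_)
    rw [WithLp.prod_dist_eq_of_L2]
    simp
  · intro r
    ext η
    simp only [Set.mem_range, Set.mem_ofPred_eq]
    constructor
    · rintro ⟨w, rfl⟩
      exact hin r w
    · intro h
      obtain ⟨q, rfl⟩ := Φ.surjective η
      have h' := hin q.fst q.snd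
      have hq : WithLp.toLp 2 (q.fst, q.snd) = q := rfl
      rw [hq, h] at h'
      refine ⟨q.snd, ?_⟩
      rw [mul_left_cancel₀ hξ' h', hq]

/-- Lebesgue measure is a multiple of Hausdorff measure. -/
lemma exists_lintegral_eq_mul_lintegral_hausdorff (n : ℕ) :
    ∃ c : ℝ≥0, ∀ f : Vd n → ℝ≥0∞, ∫⁻ w, f w = c * ∫⁻ w, f w ∂μH[(n : ℝ)] := by
  have hH : (μH[(n : ℝ)] : Measure (Vd n)).IsAddHaarMeasure := by
    have := isAddHaarMeasure_hausdorffMeasure (E := Vd n)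
    rwa [finrank_euclideanSpace_fin] at this
  refine ⟨(volume : Measure (Vd n)).addHaarScalarFactor μH[(n : ℝ)], fun f => ?_⟩
  conv_lhs => rw [Measure.isAddLeftInvariant_eq_smul (volume : Measure (Vd n)) μH[(n : ℝ)]]
  rw [lintegral_smul_measure]
  rfl

/-- The delta integral in terms of an isometric parametrization of the hyperplanes. -/
lemma deltaInt_eq_lintegral_slice {n : ℕ} {ξ : Vd (n + 1)}
    {P : ℝ × Vd n → Vd (n + 1)} (hiso : ∀ r, Isometry fun w => P (r, w))
    (hran : ∀ r, Set.range (fun w => P (r, w)) = {η | ⟪ξ, η⟫ = ‖ξ‖ * r})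
    (F : Vd (n + 1) → ℝ≥0∞) (r : ℝ) :
    deltaInt F (‖ξ‖ ^ 2 - 2 * (‖ξ‖ * r)) ξ =
      (∫⁻ w, F (P (r, w)) ∂μH[(n : ℝ)]) / (2 * (‖ξ‖₊ : ℝ≥0∞)) := by
  have hset : {η : Vd (n + 1) | 2 * ⟪ξ, η⟫ = ‖ξ‖ ^ 2 - (‖ξ‖ ^ 2 - 2 * (‖ξ‖ * r))} =
      Set.range fun w => P (r, w) := by
    rw [hran]
    ext η
    simp
  have hdim : ((n + 1 : ℕ) : ℝ) - 1 = n := by push_cast; ring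
  rw [deltaInt, hset, hdim, ← (hiso r).map_hausdorffMeasure (Or.inl n.cast_nonneg),
    (hiso r).isClosedEmbedding.measurableEmbedding.lintegral_map]

/-- The substitution `η ↦ ξ - η` reverses the sign of `τ` in the delta integral. -/
lemma deltaInt_comp_sub {d : ℕ} (F : Vd d → ℝ≥0∞) (τ : ℝ) (ξ : Vd d) :
    deltaInt (fun η => F (ξ - η)) τ ξ = deltaInt F (-τ) ξ := by
  let e : Vd d ≃ᵢ Vd d := IsometryEquiv.subLeft ξ
  have he : ∀ η, e η = ξ - η := fun η => rfl
  have hset : {η : Vd d | 2 * ⟪ξ, η⟫ = ‖ξ‖ ^ 2 - τ} =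
      e ⁻¹' {η : Vd d | 2 * ⟪ξ, η⟫ = ‖ξ‖ ^ 2 - -τ} := by
    ext η
    simp only [Set.mem_preimage, Set.mem_ofPred_eq, he, inner_sub_right, real_inner_self_eq_norm_sq]
    constructor <;> intro h <;> linarith
  rw [deltaInt, deltaInt, hset]
  congr 1
  exact (e.measurePreserving_hausdorffMeasure _).setLIntegral_comp_preimage_emb
    e.toHomeomorph.measurableEmbedding F _

lemma one_le_jb {d : ℕ} (ξ : Vd d) : 1 ≤ jb ξ :=
  Real.one_le_rpow (by nlinarith [sq_nonneg ‖ξ‖]) (by norm_num)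

lemma jb_pos {d : ℕ} (ξ : Vd d) : 0 < jb ξ := one_pos.trans_le (one_le_jb ξ)

lemma jb_le_jb {d : ℕ} {ξ η : Vd d} (h : ‖ξ‖ ≤ ‖η‖) : jb ξ ≤ jb η :=
  Real.rpow_le_rpow (by positivity) (by gcongr) (by norm_num)

lemma continuous_jb {d : ℕ} : Continuous (jb : Vd d → ℝ) :=
  (continuous_const.add (continuous_norm.pow 2)).rpow_const fun _ => Or.inr (by norm_num)

/-- For `a ≤ b`, the product `a ^ p * b ^ q` is smallest when the larger exponent sits on `a`. -/
lemma rpow_max_mul_rpow_min_le {a b p q : ℝ} (ha : 0 < a) (hab : a ≤ b) :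
    a ^ (2 * max p q) * b ^ (2 * min p q) ≤ a ^ (2 * p) * b ^ (2 * q) := by
  have hb : 0 < b := ha.trans_le hab
  rcases le_total q p with h | h
  · rw [max_eq_left h, min_eq_right h]
  · rw [max_eq_right h, min_eq_left h]
    have h1 : a ^ (2 * q) = a ^ (2 * p) * a ^ (2 * (q - p)) := by
      rw [← Real.rpow_add ha]; ring_nf
    have h2 : b ^ (2 * q) = b ^ (2 * p) * b ^ (2 * (q - p)) := by
      rw [← Real.rpow_add hb]; ring_nf
    have h3 : a ^ (2 * (q - p)) ≤ b ^ (2 * (q - p)) :=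
      Real.rpow_le_rpow ha.le hab (by linarith)
    rw [h1, h2]
    calc _ = (a ^ (2 * p) * b ^ (2 * p)) * a ^ (2 * (q - p)) := by ring
      _ ≤ (a ^ (2 * p) * b ^ (2 * p)) * b ^ (2 * (q - p)) := by gcongr
      _ = _ := by ring

/-- The full weight is controlled by its restriction to `|η| ≤ |ξ - η|` and a reflection. -/
lemma ofReal_weight_le {d : ℕ} (s α₀ α₁ α₂ : ℝ) (ξ η : Vd d) :
    ENNReal.ofReal ((‖ξ‖ ^ (2 * s) * jb ξ ^ (2 * α₀)) /
        (jb η ^ (2 * α₁) * jb (ξ - η) ^ (2 * α₂))) ≤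
      Iintegrand s α₀ α₁ α₂ ξ η + Iintegrand s α₀ α₁ α₂ ξ (ξ - η) := by
  have hA : 0 ≤ ‖ξ‖ ^ (2 * s) * jb ξ ^ (2 * α₀) := by
    have := jb_pos ξ
    positivity
  have h1 := jb_pos η
  have h2 := jb_pos (ξ - η)
  rcases le_total ‖η‖ ‖ξ - η‖ with h | h
  · refine le_add_right ?_
    rw [Iintegrand, Set.indicator_of_mem (by exact h)]
    refine ENNReal.ofReal_le_ofReal (div_le_div_of_nonneg_left hA (by positivity) ?_)
    exact rpow_max_mul_rpow_min_le h1 (jb_le_jb h)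
  · refine le_add_left ?_
    rw [Iintegrand, Set.indicator_of_mem (by simpa using h), sub_sub_cancel]
    refine ENNReal.ofReal_le_ofReal (div_le_div_of_nonneg_left hA (by positivity) ?_)
    rw [max_comm, min_comm, mul_comm (jb η ^ _)]
    exact rpow_max_mul_rpow_min_le h2 (jb_le_jb h)

/-- A uniform bound on the delta integral controls the full weight on every slice. -/
lemma lintegral_slice_weight_le {n : ℕ} {s α₀ α₁ α₂ : ℝ} {M c : ℝ≥0} {ξ : Vd (n + 1)}
    (hξ : ξ ≠ 0) (hM : ∀ τ, deltaInt (Iintegrand s α₀ α₁ α₂ ξ) τ ξ ≤ M)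
    (hc : ∀ f : Vd n → ℝ≥0∞, ∫⁻ w, f w = c * ∫⁻ w, f w ∂μH[(n : ℝ)])
    {P : ℝ × Vd n → Vd (n + 1)} (hiso : ∀ r, Isometry fun w => P (r, w))
    (hran : ∀ r, Set.range (fun w => P (r, w)) = {η | ⟪ξ, η⟫ = ‖ξ‖ * r}) (r : ℝ) :
    ∫⁻ w, ENNReal.ofReal ((‖ξ‖ ^ (2 * s) * jb ξ ^ (2 * α₀)) /
        (jb (P (r, w)) ^ (2 * α₁) * jb (ξ - P (r, w)) ^ (2 * α₂))) ≤
      c * (2 * M * (2 * (‖ξ‖₊ : ℝ≥0∞))) := by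
  have hn0 : (2 * (‖ξ‖₊ : ℝ≥0∞)) ≠ 0 := by simpa using hξ
  have hnt : (2 * (‖ξ‖₊ : ℝ≥0∞)) ≠ ∞ := ENNReal.mul_ne_top (by simp) (by simp)
  have hslice : ∀ F : Vd (n + 1) → ℝ≥0∞, ∫⁻ w, F (P (r, w)) ∂μH[(n : ℝ)] =
      deltaInt F (‖ξ‖ ^ 2 - 2 * (‖ξ‖ * r)) ξ * (2 * (‖ξ‖₊ : ℝ≥0∞)) := fun F => by
    rw [deltaInt_eq_lintegral_slice hiso hran, ENNReal.div_mul_cancel hn0 hnt]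
  have hmeas : Measurable (Iintegrand s α₀ α₁ α₂ ξ) := by
    refine Measurable.indicator ?_ (measurableSet_le (by fun_prop) (by fun_prop))
    have h1 : Measurable (jb : Vd (n + 1) → ℝ) := continuous_jb.measurable
    fun_prop
  have hmP : Measurable fun w => P (r, w) := (hiso r).continuous.measurable
  rw [hc]
  gcongr
  calc _ ≤ ∫⁻ w, (Iintegrand s α₀ α₁ α₂ ξ (P (r, w)) +
          Iintegrand s α₀ α₁ α₂ ξ (ξ - P (r, w))) ∂μH[(n : ℝ)] :=
        lintegral_mono fun w => ofReal_weight_le s α₀ α₁ α₂ ξ (P (r, w))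
    _ = (∫⁻ w, Iintegrand s α₀ α₁ α₂ ξ (P (r, w)) ∂μH[(n : ℝ)]) +
          ∫⁻ w, Iintegrand s α₀ α₁ α₂ ξ (ξ - P (r, w)) ∂μH[(n : ℝ)] :=
        lintegral_add_left (hmeas.comp hmP) _
    _ ≤ _ := by
        rw [hslice, hslice (fun η => Iintegrand s α₀ α₁ α₂ ξ (ξ - η)), deltaInt_comp_sub,
          ← add_mul, two_mul (M : ℝ≥0∞)]
        gcongr
        · exact hM _
        · exact hM _

/-- Restricting to slices turns the time oscillation into a one-dimensional Fourier transform. -/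
lemma lintegral_oscillatory_sq_le {n : ℕ} {ξ : Vd (n + 1)} (hξ : ξ ≠ 0)
    {P : ℝ × Vd n → Vd (n + 1)} (hP : MeasurePreserving P) (hPe : MeasurableEmbedding P)
    (hin : ∀ r w, ⟪ξ, P (r, w)⟫ = ‖ξ‖ * r)
    {h : Vd (n + 1) → ℂ} (hm : StronglyMeasurable h)
    {V : Vd (n + 1) → ℝ≥0∞} (hV : Measurable V) (h0 : ∀ η, V η ≠ 0) (htop : ∀ η, V η ≠ ∞)
    {K : ℝ≥0∞} (hK : ∀ r, ∫⁻ w, V (P (r, w)) ≤ K) :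
    ∫⁻ t : ℝ, ‖∫ η, Complex.exp (-(Complex.I *
        Complex.ofReal (t * (‖η‖ ^ 2 - ‖ξ - η‖ ^ 2)))) * h η‖ₑ ^ (2 : ℝ) ≤
      ENNReal.ofReal (Real.pi / ‖ξ‖) * (K * ∫⁻ η, (V η)⁻¹ * ‖h η‖ₑ ^ (2 : ℝ)) := by
  have hξ' : 0 < ‖ξ‖ := norm_pos_iff.2 hξ
  have hexp : ∀ x : ℝ, ‖Complex.exp (-(Complex.I * (x : ℂ)))‖ = 1 := fun x => by
    rw [Complex.norm_exp]; simp
  by_cases hint : Integrable h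
  swap
  · have hz : ∀ t : ℝ, ∫ η, Complex.exp (-(Complex.I *
        Complex.ofReal (t * (‖η‖ ^ 2 - ‖ξ - η‖ ^ 2)))) * h η = 0 := fun t => by
      refine integral_undef fun H => hint (H.mono hm.aestronglyMeasurable ?_)
      refine Eventually.of_forall fun η => ?_
      rw [norm_mul, hexp, one_mul]
    simp only [hz]
    simp
  set g : ℝ → ℂ := fun r => ∫ w, h (P (r, w)) with hg
  have hintP : Integrable (fun p => h (P p)) := (hP.integrable_comp_emb hPe).2 hint
  have hgi : Integrable g := Integrable.integral_prod_left hintP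
  have hform : ∀ t : ℝ, ‖∫ η, Complex.exp (-(Complex.I *
        Complex.ofReal (t * (‖η‖ ^ 2 - ‖ξ - η‖ ^ 2)))) * h η‖ₑ =
      ‖FourierTransform.fourier g (t * (‖ξ‖ / Real.pi))‖ₑ := fun t => by
    have hph : ∀ r w, Complex.exp (-(Complex.I *
          Complex.ofReal (t * (‖P (r, w)‖ ^ 2 - ‖ξ - P (r, w)‖ ^ 2)))) =
        Complex.exp (-(Complex.I * Complex.ofReal (-(t * ‖ξ‖ ^ 2)))) *
          Complex.exp (↑(-2 * Real.pi * ⟪r, t * (‖ξ‖ / Real.pi)⟫) * Complex.I) := fun r w => by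
      have hsq : ‖P (r, w)‖ ^ 2 - ‖ξ - P (r, w)‖ ^ 2 = 2 * (‖ξ‖ * r) - ‖ξ‖ ^ 2 := by
        rw [norm_sub_sq_real, hin]; ring
      have hre : (-2 * Real.pi * ⟪r, t * (‖ξ‖ / Real.pi)⟫ : ℝ) = -(2 * t * ‖ξ‖ * r) := by
        simp only [RCLike.inner_apply, conj_trivial]
        field_simp
      rw [hsq, hre, ← Complex.exp_add]
      congr 1
      push_cast
      ring
    have hcalc : ∫ η, Complex.exp (-(Complex.I *
          Complex.ofReal (t * (‖η‖ ^ 2 - ‖ξ - η‖ ^ 2)))) * h η =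
        Complex.exp (-(Complex.I * Complex.ofReal (-(t * ‖ξ‖ ^ 2)))) *
          FourierTransform.fourier g (t * (‖ξ‖ / Real.pi)) := by
      rw [← hP.integral_comp hPe, Measure.volume_eq_prod, integral_prod, Real.fourier_eq',
        ← integral_const_mul]
      · refine integral_congr_ae (Eventually.of_forall fun r => ?_)
        simp only [hph, smul_eq_mul, hg, integral_const_mul, mul_assoc]
      · refine (hintP.bdd_mul (c := 1) ?_ (Eventually.of_forall fun p => ?_))
        · refine Measurable.aestronglyMeasurable ?_
          have := hP.measurable
          fun_prop
        · exact (hexp _).le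
    rw [hcalc, enorm_mul, ← ofReal_norm (Complex.exp _), hexp]
    simp
  have ha : 0 < ‖ξ‖ / Real.pi := by positivity
  have hgm : Measurable (FourierTransform.fourier g) :=
    (VectorFourier.fourierIntegral_continuous Real.continuous_fourierChar
      (L := innerₗ ℝ) continuous_inner hgi).measurable
  calc _ = ∫⁻ t : ℝ, ‖FourierTransform.fourier g (t * (‖ξ‖ / Real.pi))‖ₑ ^ (2 : ℝ) := by
        simp only [hform]
    _ = ENNReal.ofReal (Real.pi / ‖ξ‖) * ∫⁻ x, ‖FourierTransform.fourier g x‖ₑ ^ (2 : ℝ) := by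
        rw [← lintegral_map (f := fun x => ‖FourierTransform.fourier g x‖ₑ ^ (2 : ℝ))
          (g := fun t => t * (‖ξ‖ / Real.pi)) (hgm.enorm.pow_const _) (by fun_prop),
          Real.map_volume_mul_right ha.ne', lintegral_smul_measure, smul_eq_mul,
          abs_of_pos (inv_pos.2 ha), inv_div]
    _ ≤ ENNReal.ofReal (Real.pi / ‖ξ‖) * ∫⁻ r, ‖g r‖ₑ ^ (2 : ℝ) := by
        exact mul_le_mul_right (lintegral_fourier_sq_le hgi) _
    _ ≤ ENNReal.ofReal (Real.pi / ‖ξ‖) *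
          ∫⁻ r, K * ∫⁻ w, (V (P (r, w)))⁻¹ * ‖h (P (r, w))‖ₑ ^ (2 : ℝ) := by
        gcongr with r
        have hmP : Measurable fun w => P (r, w) := hP.measurable.comp measurable_prodMk_left
        calc _ ≤ (∫⁻ w, ‖h (P (r, w))‖ₑ) ^ (2 : ℝ) := by
              gcongr
              exact enorm_integral_le_lintegral_enorm _
          _ ≤ _ := lintegral_sq_le_mul_lintegral_inv_mul (hV.comp hmP).aemeasurable
              (hm.measurable.comp hmP).enorm.aemeasurable (fun _ => h0 _) (fun _ => htop _)
          _ ≤ _ := by exact mul_le_mul_left (hK r) _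
    _ = _ := by
        have hmm : Measurable fun η => (V η)⁻¹ * ‖h η‖ₑ ^ (2 : ℝ) :=
          hV.inv.mul (hm.measurable.enorm.pow_const _)
        have hmr : Measurable fun r => ∫⁻ w, (V (P (r, w)))⁻¹ * ‖h (P (r, w))‖ₑ ^ (2 : ℝ) :=
          Measurable.lintegral_prod_right' (hmm.comp hP.measurable)
        rw [lintegral_const_mul _ hmr,
          ← hP.lintegral_comp_emb hPe, Measure.volume_eq_prod,
          lintegral_prod (fun p => (V (P p))⁻¹ * ‖h (P p)‖ₑ ^ (2 : ℝ))
            (hmm.comp hP.measurable).aemeasurable]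

lemma measurePreserving_shear (d : ℕ) :
    MeasurePreserving (fun p : Vd d × Vd d => (p.2, p.1 - p.2)) :=
  Measure.measurePreserving_swap.comp (measurePreserving_sub_prod volume volume)

/-- The time integral of the density at a fixed nonzero frequency. -/
lemma mul_lintegral_densFT_sq_le {n : ℕ} {s α₀ α₁ α₂ : ℝ} {M c : ℝ≥0} {ξ : Vd (n + 1)}
    (hξ : ξ ≠ 0) (hM : ∀ τ, deltaInt (Iintegrand s α₀ α₁ α₂ ξ) τ ξ ≤ M)
    (hc : ∀ f : Vd n → ℝ≥0∞, ∫⁻ w, f w = c * ∫⁻ w, f w ∂μH[(n : ℝ)])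
    {G : Vd (n + 1) × Vd (n + 1) → ℂ} (hG : StronglyMeasurable G) :
    ENNReal.ofReal (‖ξ‖ ^ (2 * s) * jb ξ ^ (2 * α₀)) *
        ∫⁻ t : ℝ, (‖densFT G t ξ‖₊ : ℝ≥0∞) ^ (2 : ℝ) ≤
      ((‖(((2 * Real.pi) ^ (n + 1))⁻¹ : ℝ)‖₊ ^ (2 : ℝ) * (4 * NNReal.pi * c * M) : ℝ≥0) : ℝ≥0∞) *
        ∫⁻ η, ENNReal.ofReal (jb η ^ (2 * α₁) * jb (ξ - η) ^ (2 * α₂)) *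
          (‖G (η, ξ - η)‖₊ : ℝ≥0∞) ^ (2 : ℝ) := by
  obtain ⟨P, hP, hPe, hin, hiso, hran⟩ := exists_measurePreserving_slicing n hξ
  have hξ' : 0 < ‖ξ‖ := norm_pos_iff.2 hξ
  have hjm : Measurable (jb : Vd (n + 1) → ℝ) := continuous_jb.measurable
  set A : ℝ := ‖ξ‖ ^ (2 * s) * jb ξ ^ (2 * α₀) with hA
  have hA0 : 0 < A := by
    have := jb_pos ξ
    positivity
  set W : Vd (n + 1) → ℝ := fun η => jb η ^ (2 * α₁) * jb (ξ - η) ^ (2 * α₂) with hW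
  have hW0 : ∀ η, 0 < W η := fun η => by
    have h1 := jb_pos η
    have h2 := jb_pos (ξ - η)
    positivity
  have hWm : Measurable W := by fun_prop
  have hGm : StronglyMeasurable fun η => G (η, ξ - η) :=
    hG.comp_measurable (by fun_prop)
  have hosc := lintegral_oscillatory_sq_le hξ hP hPe hin hGm
    (V := fun η => ENNReal.ofReal (A / W η)) (by fun_prop)
    (fun η => by simpa using div_pos hA0 (hW0 η)) (fun η => ENNReal.ofReal_ne_top)
    (lintegral_slice_weight_le hξ hM hc hiso hran)
  have hVinv : ∀ η, ENNReal.ofReal A * (ENNReal.ofReal (A / W η))⁻¹ = ENNReal.ofReal (W η) :=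
    fun η => by
      rw [← ENNReal.ofReal_inv_of_pos (div_pos hA0 (hW0 η)), ← ENNReal.ofReal_mul hA0.le, inv_div,
        mul_div_cancel₀ _ hA0.ne']
  have hdens : ∀ t : ℝ, (‖densFT G t ξ‖₊ : ℝ≥0∞) ^ (2 : ℝ) =
      ((‖(((2 * Real.pi) ^ (n + 1))⁻¹ : ℝ)‖₊ ^ (2 : ℝ) : ℝ≥0) : ℝ≥0∞) *
        ‖∫ η, Complex.exp (-(Complex.I * Complex.ofReal (t * (‖η‖ ^ 2 - ‖ξ - η‖ ^ 2)))) *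
          G (η, ξ - η)‖ₑ ^ (2 : ℝ) := fun t => by
    rw [densFT, nnnorm_smul, ENNReal.coe_mul, ENNReal.mul_rpow_of_nonneg _ _ (by norm_num),
      ENNReal.coe_rpow_of_nonneg _ (by norm_num)]
    rfl
  have hconst : ENNReal.ofReal (Real.pi / ‖ξ‖) * (c * (2 * M * (2 * (‖ξ‖₊ : ℝ≥0∞)))) =
      ((4 * NNReal.pi * c * M : ℝ≥0) : ℝ≥0∞) := by
    have h1 : ENNReal.ofReal (Real.pi / ‖ξ‖) = ((NNReal.pi / ‖ξ‖₊ : ℝ≥0) : ℝ≥0∞) :=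
      ENNReal.ofReal_eq_coe_nnreal (x := Real.pi / ‖ξ‖) (by positivity)
    have h2 : ‖ξ‖₊ ≠ 0 := nnnorm_ne_zero_iff.2 hξ
    rw [h1]
    norm_cast
    field_simp
    ring
  simp only [hdens]
  rw [lintegral_const_mul' _ _ ENNReal.coe_ne_top]
  calc _ ≤ ENNReal.ofReal A * (((‖(((2 * Real.pi) ^ (n + 1))⁻¹ : ℝ)‖₊ ^ (2 : ℝ) : ℝ≥0) : ℝ≥0∞) *
        (ENNReal.ofReal (Real.pi / ‖ξ‖) * ((c * (2 * M * (2 * (‖ξ‖₊ : ℝ≥0∞)))) *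
          ∫⁻ η, (ENNReal.ofReal (A / W η))⁻¹ * ‖G (η, ξ - η)‖ₑ ^ (2 : ℝ)))) :=
        mul_le_mul_right (mul_le_mul_right hosc _) _
    _ = ((‖(((2 * Real.pi) ^ (n + 1))⁻¹ : ℝ)‖₊ ^ (2 : ℝ) : ℝ≥0) : ℝ≥0∞) *
        (ENNReal.ofReal (Real.pi / ‖ξ‖) * (c * (2 * M * (2 * (‖ξ‖₊ : ℝ≥0∞))))) *
        (ENNReal.ofReal A *
          ∫⁻ η, (ENNReal.ofReal (A / W η))⁻¹ * ‖G (η, ξ - η)‖ₑ ^ (2 : ℝ)) := by ring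
    _ = _ := by
        have hWG : ∀ η, ENNReal.ofReal A * ((ENNReal.ofReal (A / W η))⁻¹ *
            ‖G (η, ξ - η)‖ₑ ^ (2 : ℝ)) = ENNReal.ofReal (W η) * ‖G (η, ξ - η)‖ₑ ^ (2 : ℝ) :=
          fun η => by rw [← mul_assoc, hVinv]
        rw [hconst, ← lintegral_const_mul' _ _ ENNReal.ofReal_ne_top, ENNReal.coe_mul,
          lintegral_congr hWG]
        rfl

/-- The density depends on `t` and `ξ` in a jointly measurable way. -/
lemma stronglyMeasurable_densFT {d : ℕ} {G : Vd d × Vd d → ℂ} (hG : StronglyMeasurable G) :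
    StronglyMeasurable fun p : ℝ × Vd d => densFT G p.1 p.2 := by
  have h1 : StronglyMeasurable fun q : (ℝ × Vd d) × Vd d => G (q.2, q.1.2 - q.2) :=
    hG.comp_measurable (by fun_prop)
  have h2 : StronglyMeasurable fun q : (ℝ × Vd d) × Vd d => Complex.exp (-(Complex.I *
      Complex.ofReal (q.1.1 * (‖q.2‖ ^ 2 - ‖q.1.2 - q.2‖ ^ 2)))) :=
    Measurable.stronglyMeasurable (by fun_prop)
  have h3 : StronglyMeasurable fun p : ℝ × Vd d => ∫ η, Complex.exp (-(Complex.I *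
      Complex.ofReal (p.1 * (‖η‖ ^ 2 - ‖p.2 - η‖ ^ 2)))) * G (η, p.2 - η) :=
    (h2.mul h1).integral_prod_right'
  exact h3.const_smul (((2 * Real.pi) ^ d)⁻¹ : ℝ)

/-- Lemma 3.4, reduction to an integral estimate.  If the delta-function
integral `I_{τ,ξ}` is bounded uniformly in `τ` and `ξ`, then the Strichartz estimate
`‖ |∇|^{α̃} ρ_{e^{itΔ}γ₀e^{-itΔ}} ‖_{L²_t H^{α₀}_x} ≲ ‖⟨∇⟩^{α₁} γ₀ ⟨∇⟩^{α₂}‖_{𝔖²}` holds for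
all Hilbert–Schmidt `γ₀` (described through `G = γ̂₀`). -/
theorem reduction_to_integral_estimate
    (d : ℕ) (hd : 1 ≤ d) (s α₀ α₁ α₂ : ℝ) (h₀ : 0 ≤ α₀) (h₁ : 0 ≤ α₁) (h₂ : 0 ≤ α₂)
    (hbdd : ∃ M : ℝ≥0, ∀ (τ : ℝ) (ξ : Vd d), ξ ≠ 0 →
      deltaInt (Iintegrand s α₀ α₁ α₂ ξ) τ ξ ≤ M) :
    ∃ C : ℝ≥0, 0 < C ∧ ∀ G : Vd d × Vd d → ℂ, AEStronglyMeasurable G volume →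
      densStriNorm s α₀ G ≤ C * wHSnorm α₁ α₂ G := by
  obtain ⟨n, rfl⟩ : ∃ n, d = n + 1 := ⟨d - 1, by omega⟩
  obtain ⟨M, hM⟩ := hbdd
  obtain ⟨c, hc⟩ := exists_lintegral_eq_mul_lintegral_hausdorff n
  set A : ℝ≥0 := ‖(((2 * Real.pi) ^ (n + 1))⁻¹ : ℝ)‖₊ ^ (2 : ℝ) * (4 * NNReal.pi * c * M) with hA
  refine ⟨A ^ (1 / 2 : ℝ) + 1, by positivity, fun G hG => ?_⟩
  set G' := hG.mk G with hG'
  have hGm : StronglyMeasurable G' := hG.stronglyMeasurable_mk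
  have hS := measurePreserving_shear (n + 1)
  have hjm : Measurable (jb : Vd (n + 1) → ℝ) := continuous_jb.measurable
  have hdens : ∀ᵐ ξ : Vd (n + 1), ∀ t, densFT G t ξ = densFT G' t ξ := by
    filter_upwards [Measure.ae_ae_of_ae_prod (hS.quasiMeasurePreserving.ae hG.ae_eq_mk)]
      with ξ hξ t
    rw [densFT, densFT]
    congr 1
    refine integral_congr_ae ?_
    filter_upwards [hξ] with η hη
    rw [hη]
  have hne : ∀ᵐ ξ : Vd (n + 1), ξ ≠ 0 := by
    simp [ae_iff]
  have hdm := stronglyMeasurable_densFT hGm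
  have hwm : Measurable fun p : Vd (n + 1) × Vd (n + 1) =>
      ENNReal.ofReal (jb p.1 ^ (2 * α₁) * jb p.2 ^ (2 * α₂)) *
        (‖G' p‖₊ : ℝ≥0∞) ^ (2 : ℝ) := by
    have := hGm.measurable
    fun_prop
  have hmain : (∫⁻ t : ℝ, ∫⁻ ξ : Vd (n + 1), ENNReal.ofReal (‖ξ‖ ^ (2 * s) * jb ξ ^ (2 * α₀)) *
        (‖densFT G t ξ‖₊ : ℝ≥0∞) ^ (2 : ℝ)) ≤
      A * ∫⁻ p : Vd (n + 1) × Vd (n + 1),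
        ENNReal.ofReal (jb p.1 ^ (2 * α₁) * jb p.2 ^ (2 * α₂)) * (‖G p‖₊ : ℝ≥0∞) ^ (2 : ℝ) := by
    calc _ = ∫⁻ t : ℝ, ∫⁻ ξ : Vd (n + 1), ENNReal.ofReal (‖ξ‖ ^ (2 * s) * jb ξ ^ (2 * α₀)) *
          (‖densFT G' t ξ‖₊ : ℝ≥0∞) ^ (2 : ℝ) := by
          refine lintegral_congr fun t => lintegral_congr_ae ?_
          filter_upwards [hdens] with ξ hξ
          rw [hξ]
      _ = ∫⁻ ξ : Vd (n + 1), ∫⁻ t : ℝ, ENNReal.ofReal (‖ξ‖ ^ (2 * s) * jb ξ ^ (2 * α₀)) *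
          (‖densFT G' t ξ‖₊ : ℝ≥0∞) ^ (2 : ℝ) := by
          refine lintegral_lintegral_swap (Measurable.aemeasurable ?_)
          refine Measurable.mul ?_ (hdm.measurable.enorm.pow_const _)
          fun_prop
      _ ≤ ∫⁻ ξ : Vd (n + 1), A * ∫⁻ η,
          ENNReal.ofReal (jb η ^ (2 * α₁) * jb (ξ - η) ^ (2 * α₂)) *
            (‖G' (η, ξ - η)‖₊ : ℝ≥0∞) ^ (2 : ℝ) := by
          refine lintegral_mono_ae ?_
          filter_upwards [hne] with ξ hξ
          rw [lintegral_const_mul' _ _ ENNReal.ofReal_ne_top]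
          exact mul_lintegral_densFT_sq_le hξ (fun τ => hM τ ξ hξ) hc hGm
      _ = A * ∫⁻ p : Vd (n + 1) × Vd (n + 1),
          ENNReal.ofReal (jb p.1 ^ (2 * α₁) * jb p.2 ^ (2 * α₂)) *
            (‖G' p‖₊ : ℝ≥0∞) ^ (2 : ℝ) := by
          rw [lintegral_const_mul' _ _ ENNReal.coe_ne_top, ← hS.lintegral_comp hwm,
            Measure.volume_eq_prod, lintegral_prod]
          exact (hwm.comp hS.measurable).aemeasurable
      _ = _ := by
          congr 1
          refine lintegral_congr_ae ?_
          filter_upwards [hG.ae_eq_mk] with p hp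
          rw [hp]
  calc densStriNorm s α₀ G ≤ _ := ENNReal.rpow_le_rpow hmain (by norm_num : (0 : ℝ) ≤ 1 / 2)
    _ = ((A ^ (1 / 2 : ℝ) : ℝ≥0) : ℝ≥0∞) * wHSnorm α₁ α₂ G := by
        rw [ENNReal.mul_rpow_of_nonneg _ _ (by norm_num),
          ENNReal.coe_rpow_of_nonneg _ (by norm_num), wHSnorm]
    _ ≤ _ := by
        gcongr
        exact le_self_add
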